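/- arXiv:2403.13359 — 2 statements merged into one kernel-verified Lean document; each statement's English description precedes it below -/
import Mathlib

section
/- Let f : ℕ → [0,∞) be a multiplicative function such that f(p^e) ≤ τ(p^e)^k · p^{-e} for all primes p, integers e ≥ 1, and some fixed k ∈ ℕ, where τ is the divisor function. Then for all x ≥ 2, the sum ∑_{n ≤ x} f(n) is bounded above and below by constant multiples (depending only on k) of exp(∑_{p ≤ x, p prime} f(p)). -/
namespace MMV

/-- The primes up to `N`. -/
abbrev P (N : ℕ) : Finset ℕ := (Finset.Icc 1 N).filter Nat.Prime

lemma mem_P {N p : ℕ} : p ∈ P N ↔ p ≤ N ∧ p.Prime := by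
  simp only [P, Finset.mem_filter, Finset.mem_Icc]
  constructor
  · rintro ⟨⟨_, h⟩, hp⟩; exact ⟨h, hp⟩
  · rintro ⟨h, hp⟩; exact ⟨⟨hp.one_le, h⟩, hp⟩

lemma prod_dvd (N : ℕ) : ∏ p ∈ P N, p ^ (N / p) ∣ N.factorial := by
  apply Finset.prod_dvd_of_isRelPrime
  · intro p hp q hq hpq
    have hp' := (mem_P.1 (Finset.mem_coe.1 hp)).2
    have hq' := (mem_P.1 (Finset.mem_coe.1 hq)).2
    exact (Nat.coprime_iff_isRelPrime.1 (Nat.Coprime.pow _ _ ((Nat.coprime_primes hp' hq').2 hpq)))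
  · intro p hp
    have hp' := (mem_P.1 hp).2
    rw [hp'.pow_dvd_factorial_iff (b := Nat.log p N + 2) (by omega)]
    have := Finset.single_le_sum (f := fun i => N / p ^ i) (s := Finset.Ico 1 (Nat.log p N + 2))
      (fun i _ => Nat.zero_le _) (a := 1) (by simp)
    simpa using this

lemma mertens_nat (N : ℕ) (hN : 2 ≤ N) :
    ∑ p ∈ P N, Real.log p / p ≤ 3 * Real.log N := by
  have hN0 : (0 : ℝ) < N := by positivity
  have h1 : ∑ p ∈ P N, ((N / p : ℕ) : ℝ) * Real.log p ≤ N * Real.log N := by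
    have e : ∑ p ∈ P N, ((N / p : ℕ) : ℝ) * Real.log p
        = Real.log ((∏ p ∈ P N, p ^ (N / p) : ℕ) : ℝ) := by
      push_cast
      rw [Real.log_prod]
      · simp [Real.log_pow]
      · intro p hp
        have := (mem_P.1 hp).2.pos
        positivity
    rw [e, ← Real.log_pow]
    apply Real.log_le_log
    · have : 0 < ∏ p ∈ P N, p ^ (N / p) :=
        Finset.prod_pos fun p hp => Nat.pow_pos (mem_P.1 hp).2.pos
      exact_mod_cast this
    · have := (Nat.le_of_dvd (Nat.factorial_pos N) (prod_dvd N)).trans (Nat.factorial_le_pow N)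
      exact_mod_cast this
  have h2 : ∑ p ∈ P N, Real.log p ≤ Real.log 4 * N := by
    have := Chebyshev.theta_le_log4_mul_x (x := (N : ℝ)) hN0.le
    rw [Chebyshev.theta_eq_sum_primesLE_log] at this
    convert this using 2
    ext p
    rw [mem_P, Nat.mem_primesLE]
  have h3 : N * ∑ p ∈ P N, Real.log p / p
      ≤ ∑ p ∈ P N, ((N / p : ℕ) : ℝ) * Real.log p + ∑ p ∈ P N, Real.log p := by
    rw [Finset.mul_sum, ← Finset.sum_add_distrib]
    apply Finset.sum_le_sum
    intro p hp
    have hp' := (mem_P.1 hp).2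
    have hp0 : (0 : ℝ) < p := by exact_mod_cast hp'.pos
    have hl : 0 ≤ Real.log p := Real.log_natCast_nonneg p
    have : (N : ℝ) / p ≤ ((N / p : ℕ) : ℝ) + 1 := by
      rw [← Nat.floor_div_eq_div (K := ℝ)]
      exact (Nat.lt_floor_add_one _).le
    calc (N : ℝ) * (Real.log p / p) = (N / p) * Real.log p := by ring
      _ ≤ (((N / p : ℕ) : ℝ) + 1) * Real.log p := by gcongr
      _ = _ := by ring
  have h4 : Real.log 4 ≤ 2 * Real.log N := by
    rw [show (4 : ℝ) = 2 ^ 2 by norm_num, Real.log_pow]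
    push_cast
    have : Real.log 2 ≤ Real.log N := Real.log_le_log (by norm_num) (by exact_mod_cast hN)
    linarith
  have h5 : (N : ℝ) * ∑ p ∈ P N, Real.log p / p ≤ N * (3 * Real.log N) := by
    nlinarith
  exact le_of_mul_le_mul_left h5 hN0

lemma mertens (y : ℝ) (hy : 1 ≤ y) :
    ∑ p ∈ P ⌊y⌋₊, Real.log p / p ≤ 3 * Real.log y := by
  rcases lt_or_ge ⌊y⌋₊ 2 with h | h
  · have : P ⌊y⌋₊ = ∅ := by
      apply Finset.eq_empty_of_forall_notMem
      intro p hp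
      have := mem_P.1 hp
      have := this.2.two_le
      omega
    rw [this, Finset.sum_empty]
    have := Real.log_nonneg hy
    linarith
  · refine (mertens_nat _ h).trans ?_
    have : Real.log (⌊y⌋₊ : ℝ) ≤ Real.log y :=
      Real.log_le_log (by positivity) (Nat.floor_le (by linarith))
    linarith

/-- The sum of inverse squares. -/
noncomputable def B : ℝ := ∑' n : ℕ, 1 / (n : ℝ) ^ 2

lemma sum_le_B (s : Finset ℕ) : ∑ n ∈ s, 1 / (n : ℝ) ^ 2 ≤ B :=
  (Real.summable_one_div_nat_pow.2 (by norm_num)).sum_le_tsum s (fun _ _ => by positivity)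

/-- The tail constant. -/
noncomputable def D (k : ℕ) : ℝ := ∑' n : ℕ, ((n + 3 : ℕ) : ℝ) ^ k * (1 / 2) ^ n

lemma summable_D (k : ℕ) : Summable (fun n : ℕ => ((n + 3 : ℕ) : ℝ) ^ k * (1 / 2 : ℝ) ^ n) := by
  have h := summable_pow_mul_geometric_of_norm_lt_one k (r := (1 / 2 : ℝ)) (by norm_num)
  have h' := ((summable_nat_add_iff 3).2 h).mul_left 8
  refine h'.congr fun n => ?_
  rw [pow_add]; ring

section
variable {k : ℕ} {f : ℕ → ℝ} (h0 : ∀ n, 0 ≤ f n) (h1 : f 1 = 1)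
  (hm : ∀ m n : ℕ, Nat.Coprime m n → f (m * n) = f m * f n)
  (hb : ∀ p e : ℕ, p.Prime → 1 ≤ e →
      f (p ^ e) ≤ ((p ^ e).divisors.card : ℝ) ^ k / (p : ℝ) ^ e)

include hb in
lemma f_prime_le {p : ℕ} (hp : p.Prime) : f p ≤ 2 ^ k / p := by
  have := hb p 1 hp le_rfl
  rw [Nat.divisors_prime_pow hp] at this
  simpa using this

include hb in
lemma f_pow_le {p : ℕ} (hp : p.Prime) (n : ℕ) :
    f (p ^ (n + 2)) ≤ (1 / (p : ℝ) ^ 2) * (((n + 3 : ℕ) : ℝ) ^ k * (1 / 2 : ℝ) ^ n) := by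
  have := hb p (n + 2) hp (by omega)
  rw [Nat.divisors_prime_pow hp] at this
  simp only [Finset.card_map, Finset.card_range] at this
  refine this.trans ?_
  have hp2 : (2 : ℝ) ≤ p := by exact_mod_cast hp.two_le
  have : (1 / (p : ℝ)) ^ n ≤ (1 / 2 : ℝ) ^ n := by gcongr
  calc ((n + 2 + 1 : ℕ) : ℝ) ^ k / (p : ℝ) ^ (n + 2)
      = (1 / (p : ℝ) ^ 2) * (((n + 3 : ℕ) : ℝ) ^ k * (1 / (p : ℝ)) ^ n) := by
        rw [pow_add, one_div_pow]; field_simp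
    _ ≤ _ := by gcongr

include h0 hb in
lemma summable_f {p : ℕ} (hp : p.Prime) : Summable (fun n => f (p ^ n)) := by
  rw [← summable_nat_add_iff 2]
  exact Summable.of_nonneg_of_le (fun _ => h0 _) (fun n => f_pow_le hb hp n)
    ((summable_D k).mul_left _)

include h0 h1 hb in
lemma tsum_f_le {p : ℕ} (hp : p.Prime) :
    ∑' n, f (p ^ n) ≤ Real.exp (f p + D k * (1 / (p : ℝ) ^ 2)) := by
  have hs := summable_f h0 hb hp
  rw [← hs.sum_add_tsum_nat_add 2]
  have : ∑' n, f (p ^ (n + 2)) ≤ (1 / (p : ℝ) ^ 2) * D k := by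
    rw [D, ← tsum_mul_left]
    exact Summable.tsum_le_tsum (fun n => f_pow_le hb hp n) ((summable_nat_add_iff 2).2 hs)
      ((summable_D k).mul_left _)
  simp only [Finset.sum_range_succ, Finset.sum_range_zero, pow_zero, pow_one, h1]
  have := Real.add_one_le_exp (f p + D k * (1 / (p : ℝ) ^ 2))
  linarith

include h0 h1 hm hb in
lemma upper (N : ℕ) :
    ∑ n ∈ Finset.Icc 1 N, f n ≤ Real.exp (D k * B) * Real.exp (∑ p ∈ P N, f p) := by
  have hP : (N + 1).primesBelow = P N := by
    ext p
    rw [mem_P, Nat.mem_primesBelow, Nat.lt_succ_iff]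
  have H := (EulerProduct.summable_and_hasSum_smoothNumbers_prod_primesBelow_tsum (f := f) h1
    (fun {m n} h => hm m n h)
    (fun hp => (summable_f h0 hb hp).norm) (N + 1)).2
  rw [hP] at H
  have hD : 0 ≤ D k := tsum_nonneg fun n => by positivity
  calc ∑ n ∈ Finset.Icc 1 N, f n
      = ∑ n ∈ (Finset.Icc 1 N).subtype (· ∈ (N + 1).smoothNumbers), f n := by
        rw [Finset.sum_subtype_eq_sum_filter, Finset.filter_true_of_mem]
        intro n hn
        rw [Finset.mem_Icc] at hn
        exact Nat.mem_smoothNumbers_of_lt (by omega) (by omega)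
    _ ≤ ∏ p ∈ P N, ∑' n, f (p ^ n) := sum_le_hasSum _ (fun _ _ => h0 _) H
    _ ≤ ∏ p ∈ P N, Real.exp (f p + D k * (1 / (p : ℝ) ^ 2)) :=
        Finset.prod_le_prod (fun p _ => tsum_nonneg fun _ => h0 _)
          (fun p hp => tsum_f_le h0 h1 hb (mem_P.1 hp).2)
    _ = Real.exp (D k * ∑ p ∈ P N, (1 / (p : ℝ) ^ 2)) * Real.exp (∑ p ∈ P N, f p) := by
        rw [← Real.exp_sum, Finset.sum_add_distrib, ← Finset.mul_sum, add_comm, Real.exp_add]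
    _ ≤ _ := by
        gcongr
        exact sum_le_B _

include h1 hm in
lemma f_prod (T : Finset ℕ) (hT : ∀ p ∈ T, p.Prime) : f (∏ p ∈ T, p) = ∏ p ∈ T, f p := by
  induction T using Finset.induction_on with
  | empty => simpa using h1
  | insert a s ha ih =>
    rw [Finset.prod_insert ha, Finset.prod_insert ha, hm, ih]
    · intro p hp; exact hT p (Finset.mem_insert_of_mem hp)
    · apply Nat.Coprime.prod_right
      intro p hp
      rw [Nat.coprime_primes (hT a (Finset.mem_insert_self _ _))
        (hT p (Finset.mem_insert_of_mem hp))]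
      rintro rfl
      exact ha hp

lemma prod_le (s : Finset ℕ) (g : ℕ → ℝ) (hg : ∀ p, 0 ≤ g p) (u : ℕ → ℝ)
    (hu : ∀ p ∈ s, 1 ≤ u p) :
    ∏ p ∈ s, (1 + g p * u p) ≤ (∏ p ∈ s, (1 + g p)) * Real.exp (∑ p ∈ s, g p * (u p - 1)) := by
  rw [Real.exp_sum, ← Finset.prod_mul_distrib]
  apply Finset.prod_le_prod
  · intro p hp
    have := hg p
    have := hu p hp
    positivity
  · intro p hp
    have a := hg p
    have b := hu p hp
    have c := Real.add_one_le_exp (g p * (u p - 1))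
    have d : 0 ≤ g p * (u p - 1) := mul_nonneg a (by linarith)
    nlinarith [mul_nonneg a d]

include h0 h1 hm hb in
lemma half (A : ℝ) (hA : A = 6 * 2 ^ k + 1) (x : ℝ) (hx : 2 ≤ x) :
    (1 / 2) * ∏ p ∈ P ⌊x ^ (1 / A)⌋₊, (1 + f p) ≤ ∑ n ∈ Finset.Icc 1 ⌊x⌋₊, f n := by
  classical
  have hA0 : 0 < A := by rw [hA]; positivity
  have hx0 : 0 < x := by linarith
  have hL : 0 < Real.log x := Real.log_pos (by linarith)
  set y := x ^ (1 / A) with hy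
  have hy1 : 1 ≤ y := Real.one_le_rpow (by linarith) (by positivity)
  have hly : Real.log y = Real.log x / A := by rw [hy, Real.log_rpow hx0]; ring
  set δ := A / Real.log x with hδ
  have hδ0 : 0 < δ := by positivity
  have hδy : δ * Real.log y = 1 := by rw [hly, hδ]; field_simp
  set S := P ⌊y⌋₊ with hS
  have hprime : ∀ p ∈ S, p.Prime := fun p hp => (mem_P.1 hp).2
  set u : ℕ → ℝ := fun p => (p : ℝ) ^ δ with hu
  have hu1 : ∀ p ∈ S, 1 ≤ u p := fun p hp =>
    Real.one_le_rpow (by exact_mod_cast (hprime p hp).one_le) hδ0.le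
  have hu2 : ∀ p ∈ S, u p - 1 ≤ 2 * (δ * Real.log p) := by
    intro p hp
    have hp0 : (0 : ℝ) < p := by exact_mod_cast (hprime p hp).pos
    have hl : 0 ≤ Real.log p := Real.log_natCast_nonneg p
    have hpy : (p : ℝ) ≤ y := (Nat.le_floor_iff (by linarith)).1 (mem_P.1 hp).1
    have hle : δ * Real.log p ≤ 1 := by
      rw [← hδy]; gcongr
    have h0' : 0 ≤ δ * Real.log p := by positivity
    have := Real.abs_exp_sub_one_le (x := δ * Real.log p) (by rw [abs_of_nonneg h0']; exact hle)
    rw [abs_of_nonneg h0'] at this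
    have e : u p = Real.exp (δ * Real.log p) := by
      rw [hu]; simp only; rw [Real.rpow_def_of_pos hp0, mul_comm]
    rw [e]
    exact (le_abs_self _).trans this
  have hsum : ∑ p ∈ S, f p * (u p - 1) ≤ 6 * 2 ^ k := by
    calc ∑ p ∈ S, f p * (u p - 1) ≤ ∑ p ∈ S, (2 ^ k * 2 * δ) * (Real.log p / p) := by
          apply Finset.sum_le_sum
          intro p hp
          have a := f_prime_le hb (hprime p hp)
          have b := hu2 p hp
          have c := hu1 p hp
          calc f p * (u p - 1) ≤ (2 ^ k / p) * (2 * (δ * Real.log p)) :=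
                mul_le_mul a b (by linarith) (by positivity)
            _ = _ := by ring
      _ = (2 ^ k * 2 * δ) * ∑ p ∈ S, (Real.log p / p) := by rw [Finset.mul_sum]
      _ ≤ (2 ^ k * 2 * δ) * (3 * Real.log y) := by
          gcongr
          exact mertens y hy1
      _ = 6 * 2 ^ k * (δ * Real.log y) := by ring
      _ = 6 * 2 ^ k := by rw [hδy, mul_one]
  have hxδ : x ^ δ = Real.exp A := by
    rw [Real.rpow_def_of_pos hx0, hδ]; congr 1; field_simp
  have hpp := prod_le S f h0 u hu1
  set Q := ∏ p ∈ S, (1 + f p) with hQ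
  have hQ0 : 0 ≤ Q := Finset.prod_nonneg fun p _ => by have := h0 p; linarith
  have hsplit : Q = ∑ T ∈ S.powerset, ∏ p ∈ T, f p := by rw [hQ, Finset.prod_one_add]
  rw [← Finset.sum_filter_add_sum_filter_not S.powerset (fun T => ∏ p ∈ T, p ≤ ⌊x⌋₊)] at hsplit
  have hsmall : ∑ T ∈ S.powerset with ∏ p ∈ T, p ≤ ⌊x⌋₊, ∏ p ∈ T, f p
      ≤ ∑ n ∈ Finset.Icc 1 ⌊x⌋₊, f n := by
    have hpr : ∀ T ∈ S.powerset.filter (fun T => ∏ p ∈ T, p ≤ ⌊x⌋₊), ∀ p ∈ T, p.Prime := by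
      intro T hT p hp
      exact hprime p (Finset.mem_powerset.1 (Finset.mem_filter.1 hT).1 hp)
    have hinj : Set.InjOn (fun T : Finset ℕ => ∏ p ∈ T, p)
        (S.powerset.filter (fun T => ∏ p ∈ T, p ≤ ⌊x⌋₊) : Finset (Finset ℕ)) := by
      intro T hT U hU h
      have h' := congrArg Nat.primeFactors h
      simp only at h'
      rwa [Nat.primeFactors_prod (hpr T hT), Nat.primeFactors_prod (hpr U hU)] at h'
    rw [Finset.sum_congr rfl (fun T hT => (f_prod h1 hm T (hpr T hT)).symm),
      ← Finset.sum_image (f := f) hinj]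
    apply Finset.sum_le_sum_of_subset_of_nonneg
    · intro n hn
      obtain ⟨T, hT, rfl⟩ := Finset.mem_image.1 hn
      rw [Finset.mem_Icc]
      exact ⟨Finset.prod_pos fun p hp => (hpr T hT p hp).pos, (Finset.mem_filter.1 hT).2⟩
    · intro n _ _; exact h0 n
  have hbig : x ^ δ * ∑ T ∈ S.powerset with ¬ ∏ p ∈ T, p ≤ ⌊x⌋₊, ∏ p ∈ T, f p
      ≤ ∏ p ∈ S, (1 + f p * u p) := by
    rw [Finset.prod_one_add, Finset.mul_sum]
    calc _ ≤ ∑ T ∈ S.powerset with ¬ ∏ p ∈ T, p ≤ ⌊x⌋₊, ∏ p ∈ T, (f p * u p) := by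
          apply Finset.sum_le_sum
          intro T hT
          have hlt := (Finset.mem_filter.1 hT).2
          rw [not_le, Nat.floor_lt hx0.le] at hlt
          rw [Finset.prod_mul_distrib, mul_comm]
          apply mul_le_mul_of_nonneg_left _ (Finset.prod_nonneg fun p _ => h0 p)
          rw [hu]
          simp only
          rw [Real.finsetProd_rpow _ _ (fun p _ => by positivity)]
          push_cast at hlt
          exact Real.rpow_le_rpow hx0.le hlt.le hδ0.le
      _ ≤ _ := by
          apply Finset.sum_le_sum_of_subset_of_nonneg (Finset.filter_subset _ _)
          intro T _ _
          exact Finset.prod_nonneg fun p _ => mul_nonneg (h0 p) (by rw [hu]; positivity)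
  set Z := ∑ T ∈ S.powerset with ¬ ∏ p ∈ T, p ≤ ⌊x⌋₊, ∏ p ∈ T, f p with hZ
  have hZ2 : Real.exp A * Z ≤ Q * Real.exp (A - 1) := by
    rw [← hxδ]
    refine hbig.trans (hpp.trans ?_)
    gcongr
    linarith
  have hZ3 : Z * 2 ≤ Q := by
    have e : Real.exp A = Real.exp (A - 1) * Real.exp 1 := by rw [← Real.exp_add]; congr 1; ring
    rw [e] at hZ2
    have h2 : 2 ≤ Real.exp 1 := by have := Real.add_one_le_exp 1; linarith
    have hZ0 : 0 ≤ Z := Finset.sum_nonneg fun T _ => Finset.prod_nonneg fun p _ => h0 p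
    have hZ4 : Real.exp (A - 1) * (Real.exp 1 * Z) ≤ Real.exp (A - 1) * Q := by linarith
    have := le_of_mul_le_mul_left hZ4 (Real.exp_pos _)
    nlinarith
  linarith

lemma exp_le_one_add {t : ℝ} (ht : 0 ≤ t) : Real.exp (t - t ^ 2) ≤ 1 + t := by
  have h := Real.one_sub_inv_le_log_of_pos (show 0 < 1 + t by linarith)
  rw [← Real.le_log_iff_exp_le (by linarith)]
  refine le_trans ?_ h
  have : 1 - (1 + t)⁻¹ - (t - t ^ 2) = t ^ 3 / (1 + t) := by field_simp; ring
  have : 0 ≤ t ^ 3 / (1 + t) := by positivity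
  linarith

include h0 h1 hm hb in
lemma lower (A : ℝ) (hA : A = 6 * 2 ^ k + 1) (x : ℝ) (hx : 2 ≤ x) :
    (1 / 2) * Real.exp (-(4 ^ k * B) - 2 ^ k * (3 * A)) * Real.exp (∑ p ∈ P ⌊x⌋₊, f p)
      ≤ ∑ n ∈ Finset.Icc 1 ⌊x⌋₊, f n := by
  classical
  refine le_trans ?_ (half h0 h1 hm hb A hA x hx)
  have hA0 : 0 < A := by rw [hA]; positivity
  have hA1 : 1 ≤ A := by
    rw [hA]
    have : (0 : ℝ) ≤ 6 * 2 ^ k := by positivity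
    linarith
  have hx0 : 0 < x := by linarith
  have hL : 0 < Real.log x := Real.log_pos (by linarith)
  set y := x ^ (1 / A) with hy
  have hy1 : 1 ≤ y := Real.one_le_rpow (by linarith) (by positivity)
  have hly : Real.log y = Real.log x / A := by rw [hy, Real.log_rpow hx0]; ring
  have hyx : y ≤ x := by
    calc y ≤ x ^ (1 : ℝ) := Real.rpow_le_rpow_of_exponent_le (by linarith)
            ((div_le_one hA0).2 hA1)
      _ = x := Real.rpow_one x
  have hsub : P ⌊y⌋₊ ⊆ P ⌊x⌋₊ := by
    intro p hp
    rw [mem_P] at hp ⊢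
    exact ⟨hp.1.trans (Nat.floor_mono hyx), hp.2⟩
  have hmid : ∑ p ∈ P ⌊x⌋₊ \ P ⌊y⌋₊, f p ≤ 2 ^ k * (3 * A) := by
    calc ∑ p ∈ P ⌊x⌋₊ \ P ⌊y⌋₊, f p
        ≤ ∑ p ∈ P ⌊x⌋₊ \ P ⌊y⌋₊, (2 ^ k * (A / Real.log x)) * (Real.log p / p) := by
          apply Finset.sum_le_sum
          intro p hp
          rw [Finset.mem_sdiff, mem_P, mem_P] at hp
          obtain ⟨⟨hpx, hpp⟩, hpy⟩ := hp
          have hlt : y < p := (Nat.floor_lt (by linarith)).1 (by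
            by_contra hcon
            exact hpy ⟨by omega, hpp⟩)
          have hll : Real.log x / A ≤ Real.log p := by
            rw [← hly]; exact Real.log_le_log (by linarith) hlt.le
          have h1' : 1 ≤ (A / Real.log x) * Real.log p := by
            rw [div_le_iff₀ hA0] at hll
            rw [div_mul_eq_mul_div, le_div_iff₀ hL]; linarith
          have hp0 : (0 : ℝ) < p := by exact_mod_cast hpp.pos
          calc f p ≤ 2 ^ k / p := f_prime_le hb hpp
            _ ≤ 2 ^ k / p * ((A / Real.log x) * Real.log p) :=
                le_mul_of_one_le_right (by positivity) h1'
            _ = _ := by ring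
      _ ≤ ∑ p ∈ P ⌊x⌋₊, (2 ^ k * (A / Real.log x)) * (Real.log p / p) := by
          apply Finset.sum_le_sum_of_subset_of_nonneg Finset.sdiff_subset
          intro p _ _
          have := Real.log_natCast_nonneg p
          positivity
      _ = (2 ^ k * (A / Real.log x)) * ∑ p ∈ P ⌊x⌋₊, (Real.log p / p) := by rw [Finset.mul_sum]
      _ ≤ (2 ^ k * (A / Real.log x)) * (3 * Real.log x) := by
          gcongr
          exact mertens x (by linarith)
      _ = _ := by field_simp
  have hsq : ∑ p ∈ P ⌊y⌋₊, (f p) ^ 2 ≤ 4 ^ k * B := by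
    calc ∑ p ∈ P ⌊y⌋₊, (f p) ^ 2 ≤ ∑ p ∈ P ⌊y⌋₊, 4 ^ k * (1 / (p : ℝ) ^ 2) := by
          apply Finset.sum_le_sum
          intro p hp
          have := pow_le_pow_left₀ (h0 p) (f_prime_le hb (mem_P.1 hp).2) 2
          refine this.trans_eq ?_
          rw [div_pow, ← pow_mul, mul_comm k 2, pow_mul]; norm_num
          rfl
      _ ≤ _ := by
          rw [← Finset.mul_sum]
          gcongr
          exact sum_le_B _
  have hspl : ∑ p ∈ P ⌊x⌋₊, f p = ∑ p ∈ P ⌊x⌋₊ \ P ⌊y⌋₊, f p + ∑ p ∈ P ⌊y⌋₊, f p :=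
    (Finset.sum_sdiff hsub).symm
  rw [mul_assoc, ← Real.exp_add]
  apply mul_le_mul_of_nonneg_left _ (by norm_num)
  calc _ ≤ Real.exp (∑ p ∈ P ⌊y⌋₊, (f p - (f p) ^ 2)) := by
        apply Real.exp_le_exp.2
        rw [Finset.sum_sub_distrib]
        linarith
    _ = ∏ p ∈ P ⌊y⌋₊, Real.exp (f p - (f p) ^ 2) := Real.exp_sum _ _
    _ ≤ _ := Finset.prod_le_prod (fun _ _ => (Real.exp_pos _).le)
        (fun p _ => exp_le_one_add (h0 p))

end

end MMV


theorem multiplicative_mean_value (k : ℕ) :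
    ∃ c₁ c₂ : ℝ, 0 < c₁ ∧ 0 < c₂ ∧
    ∀ f : ℕ → ℝ, (∀ n, 0 ≤ f n) → f 1 = 1 →
    (∀ m n : ℕ, Nat.Coprime m n → f (m * n) = f m * f n) →
    (∀ p e : ℕ, p.Prime → 1 ≤ e →
      f (p ^ e) ≤ ((p ^ e).divisors.card : ℝ) ^ k / (p : ℝ) ^ e) →
    ∀ x : ℝ, 2 ≤ x →
      c₁ * Real.exp (∑ p ∈ (Finset.Icc 1 ⌊x⌋₊).filter Nat.Prime, f p)
          ≤ ∑ n ∈ Finset.Icc 1 ⌊x⌋₊, f n ∧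
      ∑ n ∈ Finset.Icc 1 ⌊x⌋₊, f n
          ≤ c₂ * Real.exp (∑ p ∈ (Finset.Icc 1 ⌊x⌋₊).filter Nat.Prime, f p) := by

  refine ⟨(1 / 2) * Real.exp (-(4 ^ k * MMV.B) - 2 ^ k * (3 * (6 * 2 ^ k + 1))),
    Real.exp (MMV.D k * MMV.B), by positivity, by positivity, ?_⟩
  intro f h0 h1 hm hb x hx
  exact ⟨MMV.lower h0 h1 hm hb _ rfl x hx, MMV.upper h0 h1 hm hb _⟩
end

section
/- Let Q ∈ ℤ[x₁, ..., x_n] be a non-constant polynomial with no repeated irreducible factors over ℚ. Then there is a constant C depending only on Q such that for every prime p, the number of x ∈ (ℤ/p²ℤ)ⁿ with Q(x) ≡ 0 (mod p²) is at most C · p^{2n - 2}. -/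
namespace SqfreeAux

section change
open MvPolynomial
variable {k : Type*} [CommRing k] {n : ℕ} (N : ℕ)

/-- `X_0 ↦ X_0` and `X_i ↦ X_i + c X_0 ^ (N ^ i)`. -/
noncomputable abbrev T1 (c : k) :
    MvPolynomial (Fin (n + 1)) k →ₐ[k] MvPolynomial (Fin (n + 1)) k :=
  aeval fun i ↦ if i = 0 then X 0 else X i + c • X 0 ^ (N ^ i.1)

lemma t1_comp_t1_neg (c : k) :
    (T1 (n := n) N c).comp (T1 N (-c)) = AlgHom.id _ _ := by
  rw [comp_aeval, ← MvPolynomial.aeval_X_left]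
  ext i v
  cases i using Fin.cases <;> simp

/-- The triangular automorphism. -/
noncomputable abbrev T : MvPolynomial (Fin (n + 1)) k ≃ₐ[k] MvPolynomial (Fin (n + 1)) k :=
  AlgEquiv.ofAlgHom (T1 N 1) (T1 N (-1))
  (t1_comp_t1_neg N 1) (by simpa using t1_comp_t1_neg N (-1 : k))

lemma sum_r_mul_ne (hN : 1 < N) (v w : Fin (n + 1) →₀ ℕ)
    (vlt : ∀ i, v i < N) (wlt : ∀ i, w i < N) (ne : v ≠ w) :
    ∑ x : Fin (n + 1), N ^ x.1 * v x ≠ ∑ x : Fin (n + 1), N ^ x.1 * w x := by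
  intro h
  refine ne <| Finsupp.ext <| congrFun <| List.ofFn_inj.mp ?_
  apply Nat.ofDigits_inj_of_len_eq hN
    (by simp) (by grind) (by grind)
  simpa only [Nat.ofDigits_eq_sum_mapIdx, List.mapIdx_eq_ofFn, List.get_ofFn, List.length_ofFn,
    Fin.val_cast, mul_comm, List.sum_ofFn] using! h

variable [IsDomain k]

lemma degreeOf_zero_t (hN : 1 < N) (v : Fin (n + 1) →₀ ℕ) {a : k} (ha : a ≠ 0) :
    ((T N) (monomial v a)).degreeOf 0 = ∑ i : Fin (n + 1), N ^ i.1 * v i := by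
  have hN0 : N ≠ 0 := by omega
  rw [← natDegree_finSuccEquiv, monomial_eq, Finsupp.prod_pow v fun a ↦ X a]
  simp only [Fin.prod_univ_succ, Fin.sum_univ_succ, map_mul, map_prod, map_pow,
    AlgEquiv.ofAlgHom_apply, MvPolynomial.aeval_C, MvPolynomial.aeval_X, if_pos, Fin.succ_ne_zero,
    ite_false, one_smul, map_add, finSuccEquiv_X_zero, finSuccEquiv_X_succ, algebraMap_eq]
  have h (i : Fin n) :
      (Polynomial.C (X (R := k) i) + Polynomial.X ^ (N ^ i.succ.1)) ^ v i.succ ≠ 0 :=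
    pow_ne_zero (v i.succ) (Polynomial.leadingCoeff_ne_zero.mp <| by
      rw [add_comm, Polynomial.leadingCoeff_X_pow_add_C (by positivity)]; exact one_ne_zero)
  rw [Polynomial.natDegree_mul (by simp [ha]) (mul_ne_zero (by simp) (Finset.prod_ne_zero_iff.mpr
    (fun i _ ↦ h i))), Polynomial.natDegree_mul (by simp) (Finset.prod_ne_zero_iff.mpr (fun i _ ↦ h i)),
    Polynomial.natDegree_prod _ _ (fun i _ ↦ h i), natDegree_finSuccEquiv, degreeOf_C]
  simpa only [Polynomial.natDegree_pow, zero_add, Polynomial.natDegree_X, mul_one, Fin.val_zero, pow_zero, one_mul,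
    add_right_inj] using Finset.sum_congr rfl (fun i _ ↦ by
    rw [add_comm (Polynomial.C _), Polynomial.natDegree_X_pow_add_C, mul_comm])

lemma degreeOf_t_ne_of_ne (hN : 1 < N) (f : MvPolynomial (Fin (n + 1)) k)
    (hf : f.totalDegree < N) (v w : Fin (n + 1) →₀ ℕ)
    (hv : v ∈ f.support) (hw : w ∈ f.support) (ne : v ≠ w) :
    (T N <| monomial v <| coeff v f).degreeOf 0 ≠
    (T N <| monomial w <| coeff w f).degreeOf 0 := by
  rw [degreeOf_zero_t _ hN _ <| mem_support_iff.mp hv, degreeOf_zero_t _ hN _ <| mem_support_iff.mp hw]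
  refine sum_r_mul_ne N hN v w (fun i ↦ ?_) (fun i ↦ ?_) ne <;>
  exact lt_of_le_of_lt ((monomial_le_degreeOf i ‹_›).trans (degreeOf_le_totalDegree f i)) hf

lemma leadingCoeff_finSuccEquiv_t (hN : 1 < N) (v : Fin (n + 1) →₀ ℕ) (a : k) :
    (finSuccEquiv k n ((T N) ((monomial v) a))).leadingCoeff = C a := by
  have hN0 : N ≠ 0 := by omega
  rw [monomial_eq, Finsupp.prod_fintype]
  · simp only [map_mul, map_prod, Polynomial.leadingCoeff_mul, Polynomial.leadingCoeff_prod]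
    rw [AlgEquiv.ofAlgHom_apply, algHom_C, algebraMap_eq, finSuccEquiv_apply,
      eval₂Hom_C, RingHom.coe_comp]
    simp only [AlgEquiv.ofAlgHom_apply, Function.comp_apply, Polynomial.leadingCoeff_C, map_pow,
      Polynomial.leadingCoeff_pow]
    have : ∀ j, ((finSuccEquiv k n) ((T1 N) 1 (X j))).leadingCoeff = 1 := fun j ↦ by
      by_cases h : j = 0
      · simp [h, finSuccEquiv_apply]
      · simp only [aeval_eq_bind₁, bind₁_X_right, if_neg h, one_smul, map_add, map_pow]
        obtain ⟨i, rfl⟩ := Fin.exists_succ_eq.mpr h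
        rw [finSuccEquiv_X_succ, finSuccEquiv_X_zero, add_comm,
          Polynomial.leadingCoeff_X_pow_add_C (by positivity)]
    simp only [this, one_pow, Finset.prod_const_one, mul_one]
  exact fun i ↦ pow_zero _

lemma T_leadingcoeff (hN : 1 < N) (f : MvPolynomial (Fin (n + 1)) k)
    (hf : f.totalDegree < N) (fne : f ≠ 0) :
    ∃ c : k, c ≠ 0 ∧ (finSuccEquiv k n (T N f)).leadingCoeff = C c := by
  obtain ⟨v, vin, vs⟩ := Finset.exists_max_image f.support
    (fun v ↦ (T N ((monomial v) (coeff v f))).degreeOf 0) (support_nonempty.mpr fne)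
  set h := fun w ↦ (MvPolynomial.monomial w) (coeff w f)
  simp only [← natDegree_finSuccEquiv] at vs
  replace vs : ∀ x ∈ f.support \ {v}, (finSuccEquiv k n ((T N) (h x))).degree <
      (finSuccEquiv k n ((T N) (h v))).degree := by
    intro x hx
    obtain ⟨h1, h2⟩ := Finset.mem_sdiff.mp hx
    apply Polynomial.degree_lt_degree <| lt_of_le_of_ne (vs x h1) ?_
    simpa only [natDegree_finSuccEquiv]
      using degreeOf_t_ne_of_ne N hN f hf _ _ h1 vin <| by simpa using h2
  have coeff : (finSuccEquiv k n ((T N) (h v + ∑ x ∈ f.support \ {v}, h x))).leadingCoeff =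
      (finSuccEquiv k n ((T N) (h v))).leadingCoeff := by
    simp only [map_add, map_sum]
    rw [add_comm]
    apply Polynomial.leadingCoeff_add_of_degree_lt <| (lt_of_le_of_lt <| Polynomial.degree_sum_le _ _) ?_
    have h2 : h v ≠ 0 := by simpa [h] using mem_support_iff.mp vin
    replace h2 : (finSuccEquiv k n ((T N) (h v))) ≠ 0 := fun eq ↦ h2 <|
      by simpa only [map_eq_zero_iff _ (AlgEquiv.injective _)] using eq
    exact (Finset.sup_lt_iff <| Ne.bot_lt (fun x ↦ h2 <| Polynomial.degree_eq_bot.mp x)).mpr vs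
  refine ⟨f.coeff v, mem_support_iff.mp vin, ?_⟩
  rw [leadingCoeff_finSuccEquiv_t N hN] at coeff
  nth_rw 1 [← f.support_sum_monomial_coeff]
  rw [Finset.sum_eq_add_sum_sdiff_singleton_of_mem vin h]
  exact coeff

end change

section poly
open Polynomial

lemma T_map {R S : Type*} [CommRing R] [CommRing S] (φ : R →+* S) {n : ℕ} (N : ℕ)
    (f : MvPolynomial (Fin (n + 1)) R) :
    MvPolynomial.map φ (T N f) = T N (MvPolynomial.map φ f) := by
  simp only [T, AlgEquiv.ofAlgHom_apply, T1, MvPolynomial.aeval_eq_bind₁, MvPolynomial.map_bind₁]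
  congr 2
  ext1 i
  split_ifs <;> simp

lemma finSucc_map {R S : Type*} [CommRing R] [CommRing S] (φ : R →+* S) {n : ℕ}
    (f : MvPolynomial (Fin (n + 1)) R) :
    (MvPolynomial.finSuccEquiv R n f).map (MvPolynomial.map φ) =
      MvPolynomial.finSuccEquiv S n (MvPolynomial.map φ f) := by
  induction f using MvPolynomial.induction_on with
  | C a => simp [MvPolynomial.finSuccEquiv_apply]
  | add p q hp hq => simp [hp, hq]
  | mul_X p i hp =>
    simp only [map_mul, Polynomial.map_mul, hp, MvPolynomial.map_X]
    congr 1
    cases i using Fin.cases <;> simp [MvPolynomial.finSuccEquiv_X_zero, MvPolynomial.finSuccEquiv_X_succ]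

lemma squarefree_equiv {A B : Type*} [CommRing A] [CommRing B] (e : A ≃+* B) {a : A}
    (h : Squarefree a) : Squarefree (e a) := by
  intro x hx
  have h1 := map_dvd e.symm hx
  rw [map_mul, RingEquiv.symm_apply_apply] at h1
  have h2 := (h _ h1).map e
  rwa [RingEquiv.apply_symm_apply] at h2

lemma eval_T {R : Type*} [CommRing R] {n : ℕ} (N : ℕ) (f : MvPolynomial (Fin (n + 1)) R)
    (x : Fin (n + 1) → R) :
    MvPolynomial.eval (fun i => if i = 0 then x 0 else x i - x 0 ^ (N ^ i.1)) (T N f) =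
      MvPolynomial.eval x f := by
  simp only [T, AlgEquiv.ofAlgHom_apply, T1]
  rw [MvPolynomial.map_aeval, MvPolynomial.coe_eval₂Hom]
  have : (MvPolynomial.eval (fun i : Fin (n+1) => if i = 0 then x 0 else x i - x 0 ^ (N ^ i.1))).comp
      (algebraMap R (MvPolynomial (Fin (n + 1)) R)) = RingHom.id R := by
    ext a; simp
  rw [this, MvPolynomial.eval₂_id]
  congr 2
  ext1 i
  split_ifs with h <;> simp [h]


section counting
variable {p : ℕ} [hp : Fact p.Prime]

/-- reduction mod p -/
noncomputable abbrev red (p : ℕ) : ZMod (p ^ 2) →+* ZMod p :=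
  ZMod.castHom (Dvd.intro_left (p ^ 1) (by ring)) (ZMod p)

lemma red_val (y : ZMod (p ^ 2)) : (red p y).val = y.val % p := by
  have : red p y = ((y.val : ℕ) : ZMod p) := by
    conv_lhs => rw [← ZMod.natCast_zmod_val y]
    rw [map_natCast]
  rw [this, ZMod.val_natCast]

lemma fiber_card (a : ZMod p) :
    (Finset.univ.filter (fun y : ZMod (p ^ 2) => red p y = a)).card ≤ p := by
  have hp0 := hp.out.pos
  conv_rhs => rw [← Finset.card_range p]
  apply Finset.card_le_card_of_injOn (fun y => y.val / p)
  · intro y _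
    have := ZMod.val_lt y
    simp only [Finset.coe_range, Set.mem_Iio]
    rw [Nat.div_lt_iff_lt_mul hp0]
    nlinarith
  · intro y hy z hz h
    simp only [Finset.coe_filter, Finset.mem_univ, true_and, Set.mem_ofPred_eq] at hy hz h
    apply ZMod.val_injective
    have h1 := red_val y
    have h2 := red_val z
    rw [hy] at h1
    rw [hz] at h2
    rw [← Nat.div_add_mod y.val p, ← Nat.div_add_mod z.val p, h, ← h1, ← h2]

lemma red_eq_sq {y z : ZMod (p ^ 2)} (h : red p y = red p z) : (y - z) ^ 2 = 0 := by
  have h0 : red p (y - z) = 0 := by rw [map_sub, h, sub_self]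
  have h1 := red_val (y - z)
  rw [h0, ZMod.val_zero] at h1
  obtain ⟨k, hk⟩ := Nat.dvd_of_mod_eq_zero h1.symm
  rw [← ZMod.natCast_zmod_val (y - z), hk, ← Nat.cast_pow, mul_pow, Nat.cast_mul,
    ZMod.natCast_self, zero_mul]

lemma red_isUnit {y : ZMod (p ^ 2)} (h : red p y ≠ 0) : IsUnit y := by
  rw [← ZMod.natCast_zmod_val y, ZMod.isUnit_iff_coprime]
  apply Nat.Coprime.pow_right
  rw [Nat.coprime_comm, Nat.Prime.coprime_iff_not_dvd hp.out]
  intro hd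
  apply h
  rw [← ZMod.natCast_zmod_val y, map_natCast]
  exact (ZMod.natCast_eq_zero_iff _ _).2 hd

lemma image_roots_card {d : ℕ} (f : (ZMod (p ^ 2))[X]) (hf : f.map (red p) ≠ 0)
    (hd : (f.map (red p)).natDegree ≤ d) :
    ((Finset.univ.filter (fun y : ZMod (p ^ 2) => f.eval y = 0)).image (red p)).card ≤ d := by
  refine le_trans (Finset.card_le_card ?_) (le_trans (Multiset.toFinset_card_le _)
    (le_trans (Polynomial.card_roots' (f.map (red p))) hd))
  intro a ha
  simp only [Finset.mem_image, Finset.mem_filter, Finset.mem_univ, true_and] at ha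
  obtain ⟨y, hy, rfl⟩ := ha
  rw [Multiset.mem_toFinset, Polynomial.mem_roots hf, Polynomial.IsRoot.def,
    Polynomial.eval_map_apply, hy, map_zero]

lemma roots_card {d : ℕ} (f : (ZMod (p ^ 2))[X]) (hf : f.map (red p) ≠ 0)
    (hd : (f.map (red p)).natDegree ≤ d) :
    (Finset.univ.filter (fun y : ZMod (p ^ 2) => f.eval y = 0)).card ≤ d * p := by
  refine le_trans (Finset.card_le_mul_card_image (f := red p) _ p ?_) ?_
  · intro a _
    refine le_trans (Finset.card_le_card ?_) (fiber_card a)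
    intro y hy
    simp only [Finset.mem_filter, Finset.mem_univ, true_and] at hy ⊢
    exact hy.2
  · rw [mul_comm]
    exact Nat.mul_le_mul_right _ (image_roots_card f hf hd)

lemma roots_card_sep {d : ℕ} (f : (ZMod (p ^ 2))[X]) (hf : f.map (red p) ≠ 0)
    (hd : (f.map (red p)).natDegree ≤ d) (a b : (ZMod (p ^ 2))[X]) (u : ZMod (p ^ 2))
    (hu : red p u ≠ 0) (h : a * f + b * derivative f = C u) :
    (Finset.univ.filter (fun y : ZMod (p ^ 2) => f.eval y = 0)).card ≤ d := by
  rw [← Finset.card_image_of_injOn (f := red p)]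
  · exact image_roots_card f hf hd
  · intro y hy z hz hyz
    simp only [Finset.coe_filter, Finset.mem_univ, true_and, Set.mem_ofPred_eq] at hy hz
    have h1 := eval_add_of_sq_eq_zero f z (y - z) (red_eq_sq hyz)
    rw [add_sub_cancel, hy, hz, zero_add] at h1
    have h2 : IsUnit (eval z (derivative f)) := by
      have h3 := congrArg (eval z) h
      simp only [eval_add, eval_mul, eval_C, hz, mul_zero, zero_add] at h3
      have h4 := red_isUnit hu
      rw [← h3] at h4
      exact isUnit_of_mul_isUnit_right h4
    exact sub_eq_zero.1 ((h2.mul_right_eq_zero).1 h1.symm)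

lemma bad_card {m : ℕ} (D : MvPolynomial (Fin m) ℤ)
    (hD : MvPolynomial.map (Int.castRingHom (ZMod p)) D ≠ 0) :
    (Finset.univ.filter (fun s : Fin m → ZMod (p ^ 2) =>
      red p (MvPolynomial.eval₂Hom (Int.castRingHom (ZMod (p ^ 2))) s D) = 0)).card * p
      ≤ D.totalDegree * p ^ (2 * m) := by
  classical
  set F := MvPolynomial.map (Int.castRingHom (ZMod p)) D with hF
  have hp0 := hp.out.pos
  have hsz := MvPolynomial.schwartz_zippel_totalDegree hD (Finset.univ : Finset (ZMod p))
  rw [Finset.card_univ, ZMod.card, Fintype.piFinset_univ, div_le_div_iff₀ (by positivity) (by positivity)] at hsz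
  have hsz' : (Finset.univ.filter (fun t : Fin m → ZMod p => MvPolynomial.eval t F = 0)).card * p
      ≤ D.totalDegree * p ^ m := by
    have : (Finset.univ.filter (fun t : Fin m → ZMod p => MvPolynomial.eval t F = 0)).card * p
      ≤ F.totalDegree * p ^ m := by exact_mod_cast hsz
    refine this.trans (Nat.mul_le_mul_right _ ?_)
    exact Finset.sup_mono (MvPolynomial.support_map_subset _ _)
  set G : (Fin m → ZMod (p ^ 2)) → (Fin m → ZMod p) := fun s i => red p (s i) with hG
  have key : (Finset.univ.filter (fun s : Fin m → ZMod (p ^ 2) =>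
      red p (MvPolynomial.eval₂Hom (Int.castRingHom (ZMod (p ^ 2))) s D) = 0)).card ≤
      p ^ m * (Finset.univ.filter (fun t : Fin m → ZMod p => MvPolynomial.eval t F = 0)).card := by
    refine Finset.card_le_mul_card_image_of_maps_to (f := G) ?_ _ ?_
    · intro s hs
      simp only [Finset.mem_filter, Finset.mem_univ, true_and] at hs ⊢
      rw [← hs, hF, MvPolynomial.eval_map, MvPolynomial.coe_eval₂Hom, MvPolynomial.hom_eval₂]
      congr 1
      exact Subsingleton.elim _ _
    · intro t _
      refine le_trans (Finset.card_le_card (t := Fintype.piFinset fun i =>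
        Finset.univ.filter (fun y : ZMod (p ^ 2) => red p y = t i)) ?_) ?_
      · intro s hs
        simp only [Finset.mem_filter, Fintype.mem_piFinset, Finset.mem_univ, true_and] at hs ⊢
        intro i
        exact congrFun hs.2 i
      · rw [Fintype.card_piFinset]
        refine (Finset.prod_le_prod' (fun i _ => fiber_card (t i))).trans ?_
        simp
  calc _ ≤ _ := Nat.mul_le_mul_right p key
    _ = p ^ m * ((Finset.univ.filter (fun t : Fin m → ZMod p => MvPolynomial.eval t F = 0)).card * p) := by ring
    _ ≤ p ^ m * (D.totalDegree * p ^ m) := Nat.mul_le_mul_left _ hsz'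
    _ = _ := by ring

lemma total_card {m : ℕ} (P : (MvPolynomial (Fin m) ℤ)[X]) (c : ℤ)
    (hc : P.leadingCoeff = MvPolynomial.C c) (hcp : (c : ZMod p) ≠ 0)
    (A B : (MvPolynomial (Fin m) ℤ)[X]) (D : MvPolynomial (Fin m) ℤ)
    (hAB : A * P + B * derivative P = C D)
    (hD : MvPolynomial.map (Int.castRingHom (ZMod p)) D ≠ 0) :
    (Finset.univ.filter (fun z : (Fin m → ZMod (p ^ 2)) × ZMod (p ^ 2) =>
      (P.map (MvPolynomial.eval₂Hom (Int.castRingHom (ZMod (p ^ 2))) z.1)).eval z.2 = 0)).card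
      ≤ (P.natDegree + P.natDegree * D.totalDegree) * p ^ (2 * m) := by
  classical
  set d := P.natDegree
  let φ : (Fin m → ZMod (p ^ 2)) → MvPolynomial (Fin m) ℤ →+* ZMod (p ^ 2) :=
    fun s => MvPolynomial.eval₂Hom (Int.castRingHom (ZMod (p ^ 2))) s
  let bad := Finset.univ.filter (fun s : Fin m → ZMod (p ^ 2) => red p (φ s D) = 0)
  have hne : ∀ s, (P.map (φ s)).map (red p) ≠ 0 := by
    intro s h
    apply hcp
    have := congrArg (fun q => q.coeff d) h
    simp only [coeff_map, coeff_zero] at this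
    change red p (φ s P.leadingCoeff) = 0 at this
    rw [hc] at this
    simpa [φ] using this
  have hdeg : ∀ s, ((P.map (φ s)).map (red p)).natDegree ≤ d := fun s =>
    natDegree_map_le.trans natDegree_map_le
  have h1 : ∀ s, (Finset.univ.filter (fun y => (P.map (φ s)).eval y = 0)).card ≤
      d + if s ∈ bad then d * p else 0 := by
    intro s
    split_ifs with hs
    · exact (roots_card _ (hne s) (hdeg s)).trans (Nat.le_add_left _ _)
    · refine (roots_card_sep _ (hne s) (hdeg s) (A.map (φ s)) (B.map (φ s)) (φ s D) ?_ ?_)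
      · exact fun h => hs (Finset.mem_filter.2 ⟨Finset.mem_univ _, h⟩)
      · have := congrArg (Polynomial.map (φ s)) hAB
        simpa [Polynomial.derivative_map] using this
  have h2 : (Finset.univ.filter (fun z : (Fin m → ZMod (p ^ 2)) × ZMod (p ^ 2) =>
      (P.map (φ z.1)).eval z.2 = 0)).card =
      ∑ s, (Finset.univ.filter (fun y => (P.map (φ s)).eval y = 0)).card := by
    simp only [Finset.card_filter]
    rw [Fintype.sum_prod_type]
  change (Finset.univ.filter (fun z : (Fin m → ZMod (p ^ 2)) × ZMod (p ^ 2) =>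
      (P.map (φ z.1)).eval z.2 = 0)).card ≤ _
  rw [h2]
  refine (Finset.sum_le_sum (fun s _ => h1 s)).trans ?_
  rw [Finset.sum_add_distrib, Finset.sum_ite_mem, Finset.univ_inter, Finset.sum_const,
    Finset.sum_const, Finset.card_univ, Fintype.card_fun, ZMod.card, Fintype.card_fin]
  have hb : bad.card * p ≤ D.totalDegree * p ^ (2 * m) := bad_card D hD
  simp only [smul_eq_mul]
  calc _ = d * p ^ (2 * m) + d * (bad.card * p) := by ring
    _ ≤ d * p ^ (2 * m) + d * (D.totalDegree * p ^ (2 * m)) := by gcongr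
    _ = _ := by ring

end counting

lemma sep_of_sqfree_monic {R : Type*} (K : Type*) [CommRing R] [IsDomain R] [IsIntegrallyClosed R] [Field K]
    [CharZero K] [Algebra R K] [IsFractionRing R K] (P : R[X]) (hP : P.Monic)
    (hs : Squarefree P) : (P.map (algebraMap R K)).Separable := by
  rw [PerfectField.separable_iff_squarefree]
  intro x hx
  have hx1 : x ∣ P.map (algebraMap R K) := (dvd_mul_right x x).trans hx
  have hx0 : x ≠ 0 := ne_zero_of_dvd_ne_zero (hP.map _).ne_zero hx1
  have hl : x.leadingCoeff ≠ 0 := leadingCoeff_ne_zero.2 hx0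
  obtain ⟨g, hg⟩ := IsIntegrallyClosed.eq_map_mul_C_of_dvd K hP hx1
  have hinj := IsFractionRing.injective R K
  have hgm : g.Monic := by
    have h := congrArg leadingCoeff hg
    rw [leadingCoeff_mul, leadingCoeff_C, leadingCoeff_map_of_injective hinj] at h
    have h2 : algebraMap R K g.leadingCoeff = 1 := mul_right_cancel₀ hl (by rw [h, one_mul])
    exact hinj (by rw [h2, map_one])
  have hdvd : g * g ∣ P := by
    rw [← map_dvd_map (algebraMap R K) hinj (hgm.mul hgm), Polynomial.map_mul]
    refine dvd_trans ?_ hx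
    exact mul_dvd_mul (Dvd.intro _ hg) (Dvd.intro _ hg)
  have hu := hs g hdvd
  rw [← hg]
  exact (hu.map (mapRingHom (algebraMap R K))).mul (isUnit_C.2 hl.isUnit)

lemma sep_of_sqfree {R : Type*} (K : Type*) [CommRing R] [IsDomain R] [IsIntegrallyClosed R] [Field K]
    [CharZero K] [Algebra R K] [IsFractionRing R K] (P : R[X]) (hP : IsUnit P.leadingCoeff)
    (hs : Squarefree P) : (P.map (algebraMap R K)).Separable := by
  obtain ⟨u, hu⟩ := hP
  have hassoc : P = (C (↑u⁻¹ : R) * P) * C (↑u : R) := by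
    rw [mul_comm (C (↑u⁻¹ : R)) P, mul_assoc, ← C_mul, Units.inv_mul, C_1, mul_one]
  have hmon : (C (↑u⁻¹ : R) * P).Monic := by
    rw [Monic, leadingCoeff_mul, leadingCoeff_C, ← hu, Units.inv_mul]
  have hsq : Squarefree (C (↑u⁻¹ : R) * P) := by
    refine hs.squarefree_of_dvd ?_
    exact Dvd.intro _ hassoc.symm
  have h := sep_of_sqfree_monic K _ hmon hsq
  rw [Polynomial.map_mul, map_C] at h
  exact h.of_mul_right

lemma clear_denoms {R S : Type*} [CommRing R] [CommRing S] [IsDomain R] [IsDomain S] [Algebra R S] (M : Submonoid R)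
    (hM : (0 : R) ∉ M) [IsLocalization M S] (hinj : Function.Injective (algebraMap R S)) (P : R[X]) (d : S) (hd : d ≠ 0) (a b : S[X])
    (h : a * P.map (algebraMap R S) + b * derivative (P.map (algebraMap R S)) = C d) :
    ∃ (A B : R[X]) (D : R), D ≠ 0 ∧ A * P + B * derivative P = C D := by
  obtain ⟨r, hr, hA⟩ := IsLocalization.integerNormalization_spec M a
  obtain ⟨s, hs, hB⟩ := IsLocalization.integerNormalization_spec M b
  obtain ⟨⟨e, t⟩, ht⟩ := IsLocalization.surj M d
  set A := IsLocalization.integerNormalization M a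
  set B := IsLocalization.integerNormalization M b
  simp only at ht
  rw [← algebraMap_smul S r a, smul_eq_C_mul] at hA
  rw [← algebraMap_smul S s b, smul_eq_C_mul] at hB
  have h0 : ∀ x ∈ M, algebraMap R S x ≠ 0 := fun x hx h' =>
    hM (by rwa [← (map_eq_zero_iff _ hinj).1 h'])
  refine ⟨C (s * t) * A, C (r * t) * B, r * s * e, ?_, ?_⟩
  · intro h'
    have := congrArg (algebraMap R S) h'
    rw [map_mul, ← ht, map_zero, map_mul] at this
    exact (mul_ne_zero (mul_ne_zero (h0 r hr) (h0 s hs)) (mul_ne_zero hd (h0 t t.2))) this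
  · apply map_injective _ hinj
    simp only [Polynomial.map_add, Polynomial.map_mul, map_C, hA, hB, map_mul, ← ht, ← derivative_map]
    rw [← h]
    ring


lemma exists_disc {m : ℕ} (P : (MvPolynomial (Fin m) ℤ)[X]) (c : ℤ) (hc0 : c ≠ 0)
    (hc : P.leadingCoeff = MvPolynomial.C c)
    (hs : Squarefree (P.map (MvPolynomial.map (Int.castRingHom ℚ)))) :
    ∃ (A B : (MvPolynomial (Fin m) ℤ)[X]) (D : MvPolynomial (Fin m) ℤ), D ≠ 0 ∧
      A * P + B * derivative P = C D := by
  letI := MvPolynomial.algebraMvPolynomial (σ := Fin m) (R := ℤ) (S := ℚ)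
  have halg : algebraMap (MvPolynomial (Fin m) ℤ) (MvPolynomial (Fin m) ℚ) =
    MvPolynomial.map (Int.castRingHom ℚ) := rfl
  have hinj : Function.Injective (MvPolynomial.map (σ := Fin m) (Int.castRingHom ℚ)) :=
    MvPolynomial.map_injective _ Int.cast_injective
  let K := FractionRing (MvPolynomial (Fin m) ℚ)
  have : CharZero K := charZero_of_injective_algebraMap (R := MvPolynomial (Fin m) ℚ) (IsFractionRing.injective _ K)
  have hu : IsUnit (P.map (MvPolynomial.map (Int.castRingHom ℚ))).leadingCoeff := by
    rw [leadingCoeff_map_of_injective hinj, hc, MvPolynomial.map_C]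
    exact (IsUnit.mk0 _ (by simpa using hc0)).map MvPolynomial.C
  obtain ⟨a, b, hab⟩ := sep_of_sqfree K _ hu hs
  obtain ⟨A, B, D, hD, hAB⟩ := clear_denoms (nonZeroDivisors (MvPolynomial (Fin m) ℚ)) (by simp)
    (IsFractionRing.injective _ K) _ 1 one_ne_zero a b (by rw [hab, C_1])
  rw [← halg] at hAB
  refine clear_denoms ((nonZeroDivisors ℤ).map (MvPolynomial.C (σ := Fin m))) ?_ hinj P D hD A B hAB
  rintro ⟨x, hx, h⟩
  rw [map_eq_zero_iff _ (MvPolynomial.C_injective _ _)] at h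
  subst h
  simp at hx

lemma card_bound {m : ℕ} (Q : MvPolynomial (Fin (m + 1)) ℤ) (N : ℕ) (p : ℕ) [Fact p.Prime] :
    Nat.card {x : Fin (m + 1) → ZMod (p ^ 2) //
      MvPolynomial.eval x (MvPolynomial.map (Int.castRingHom (ZMod (p ^ 2))) Q) = 0} ≤
    (Finset.univ.filter (fun z : (Fin m → ZMod (p ^ 2)) × ZMod (p ^ 2) =>
      ((MvPolynomial.finSuccEquiv ℤ m (T N Q)).map
        (MvPolynomial.eval₂Hom (Int.castRingHom (ZMod (p ^ 2))) z.1)).eval z.2 = 0)).card := by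
  classical
  rw [Nat.card_eq_fintype_card, Fintype.card_subtype]
  let G : (Fin (m + 1) → ZMod (p ^ 2)) → (Fin (m + 1) → ZMod (p ^ 2)) :=
    fun x i => if i = 0 then x 0 else x i - x 0 ^ (N ^ i.1)
  refine Finset.card_le_card_of_injOn (fun x => (Fin.tail (G x), G x 0)) ?_ ?_
  · intro x hx
    have hx' := (Finset.mem_filter.1 hx).2
    refine Finset.mem_coe.2 (Finset.mem_filter.2 ⟨Finset.mem_univ _, ?_⟩)
    rw [← eval_T N, ← T_map] at hx'
    change MvPolynomial.eval (G x) _ = 0 at hx'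
    rw [← Fin.cons_self_tail (G x), MvPolynomial.eval_eq_eval_mv_eval', ← finSucc_map,
      Polynomial.map_map] at hx'
    rw [← hx']
    congr 2
    ext <;> simp
  · intro x _ y _ h
    simp only [Prod.mk.injEq] at h
    have hG : G x = G y := by
      rw [← Fin.cons_self_tail (G x), ← Fin.cons_self_tail (G y), h.1, h.2]
    have h0 : x 0 = y 0 := by simpa [G] using h.2
    ext1 i
    by_cases hi : i = 0
    · rw [hi, h0]
    · have := congrFun hG i
      simpa [G, hi, h0] using this

end poly
end SqfreeAux

open SqfreeAux
theorem squarefree_poly_mod_p_squared (n : ℕ) (Q : MvPolynomial (Fin n) ℤ)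
    (hdeg : 0 < Q.totalDegree)
    (hsf : Squarefree (MvPolynomial.map (Int.castRingHom ℚ) Q)) :
    ∃ C : ℝ, ∀ p : ℕ, p.Prime →
      (Nat.card {x : Fin n → ZMod (p ^ 2) //
          MvPolynomial.eval x (MvPolynomial.map (Int.castRingHom (ZMod (p ^ 2))) Q) = 0} : ℝ)
        ≤ C * (p : ℝ) ^ (2 * n - 2) := by
  rcases n with _ | m
  · rw [MvPolynomial.eq_C_of_isEmpty Q, MvPolynomial.totalDegree_C] at hdeg
    exact absurd hdeg (lt_irrefl 0)
  have hQ0 : Q ≠ 0 := by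
    rintro rfl
    simp at hdeg
  set N := Q.totalDegree + 2
  obtain ⟨c, hc0, hc⟩ := T_leadingcoeff N (by omega) Q (by omega) hQ0
  set P := MvPolynomial.finSuccEquiv ℤ m (T N Q) with hP
  have hs : Squarefree (P.map (MvPolynomial.map (Int.castRingHom ℚ))) := by
    rw [hP, finSucc_map, T_map]
    exact squarefree_equiv (MvPolynomial.finSuccEquiv ℚ m).toRingEquiv
      (squarefree_equiv (T N).toRingEquiv hsf)
  obtain ⟨A, B, D, hD, hAB⟩ := exists_disc P c hc0 hc hs
  obtain ⟨v, hv⟩ := MvPolynomial.ne_zero_iff.1 hD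
  set e := D.coeff v
  set M := (c * e).natAbs
  set K := P.natDegree + P.natDegree * D.totalDegree
  refine ⟨((M ^ (2 * (m + 1)) + K : ℕ) : ℝ), fun p hp => ?_⟩
  have : Fact p.Prime := ⟨hp⟩
  have hn : 2 * (m + 1) - 2 = 2 * m := by omega
  rw [hn]
  norm_cast
  by_cases hpd : (p : ℤ) ∣ c * e
  · have hpM : p ≤ M := Nat.le_of_dvd (Int.natAbs_pos.2 (mul_ne_zero hc0 hv))
      (Int.natCast_dvd.1 hpd)
    calc _ ≤ Nat.card (Fin (m + 1) → ZMod (p ^ 2)) :=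
          Nat.card_le_card_of_injective _ Subtype.val_injective
      _ = p ^ (2 * (m + 1)) := by simp [← pow_mul]
      _ ≤ M ^ (2 * (m + 1)) := Nat.pow_le_pow_left hpM _
      _ ≤ M ^ (2 * (m + 1)) + K := Nat.le_add_right _ _
      _ ≤ _ := Nat.le_mul_of_pos_right _ (pow_pos hp.pos _)
  · refine (card_bound Q N p).trans ?_
    refine (total_card P c hc ?_ A B D hAB ?_).trans (Nat.mul_le_mul_right _ (Nat.le_add_left _ _))
    · intro h
      exact hpd (Dvd.dvd.mul_right ((ZMod.intCast_zmod_eq_zero_iff_dvd c p).1 h) e)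
    · intro h
      have h2 := congrArg (MvPolynomial.coeff v) h
      rw [MvPolynomial.coeff_map, MvPolynomial.coeff_zero] at h2
      exact hpd (Dvd.dvd.mul_left ((ZMod.intCast_zmod_eq_zero_iff_dvd e p).1 h2) c)
end
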